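/- arXiv:1202.4798 — 2 statements merged into one kernel-verified Lean document; each statement's English description precedes it below -/
import Mathlib

section
/- Let x = P(x) be a minPPS in SNF with least fixed point q* satisfying 0 < q* < 1. For any y ∈ ℝ^n with 0 ≤ y ≤ q* and any policy σ, the matrix (I − P'_σ(y))^{-1} exists and is entrywise nonnegative; hence the Newton iterate N_σ(y) is defined. -/
open Matrix Finset

namespace PPS

/-- One equation of a max/min PPS in simple normal form (SNF):
form L (linear), form Q (product of two variables), or form M
(max or min of two variables, according to the kind of the system). -/
inductive Eqn (n : ℕ) where
  | lin (a0 : ℝ) (a : Fin n → ℝ) : Eqn n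
  | quad (j k : Fin n) : Eqn n
  | m (j k : Fin n) : Eqn n

namespace Eqn

/-- Validity of the coefficients of a form-L equation: all coefficients,
including the constant term, are nonnegative and sum to at most 1. -/
def Valid {n : ℕ} : Eqn n → Prop
  | .lin a0 a => 0 ≤ a0 ∧ (∀ j, 0 ≤ a j) ∧ a0 + ∑ j, a j ≤ 1
  | _ => True

/-- Evaluate one equation; `isMax` says whether form-M equations are max or min. -/
def eval {n : ℕ} (isMax : Bool) : Eqn n → (Fin n → ℝ) → ℝ
  | .lin a0 a, x => a0 + ∑ j, a j * x j
  | .quad j k, x => x j * x k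
  | .m j k, x => if isMax then max (x j) (x k) else min (x j) (x k)

/-- An equation of form L or Q (no max/min). -/
def IsLinOrQuad {n : ℕ} : Eqn n → Prop
  | .m _ _ => False
  | _ => True

/-- Row of the Jacobian matrix of one (form L or Q) equation at the point `y`. -/
def jacRow {n : ℕ} : Eqn n → (Fin n → ℝ) → (Fin n → ℝ)
  | .lin _ a, _ => a
  | .quad j k, y => fun l => (if l = j then y k else 0) + (if l = k then y j else 0)
  | .m _ _, _ => fun _ => 0

end Eqn

/-- A system of `n` equations in `n` variables, in SNF. -/
abbrev Sys (n : ℕ) : Type := Fin n → Eqn n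

/-- All equations have valid (probabilistic) coefficients. -/
def SysValid {n : ℕ} (S : Sys n) : Prop := ∀ i, (S i).Valid

/-- A PPS: a system with no form-M equations. -/
def IsPPS {n : ℕ} (S : Sys n) : Prop := ∀ i, (S i).IsLinOrQuad

/-- The map `P : ℝ^n → ℝ^n` of the system. -/
def eval {n : ℕ} (isMax : Bool) (S : Sys n) (x : Fin n → ℝ) : Fin n → ℝ :=
  fun i => (S i).eval isMax x

/-- The Jacobian matrix `P'(y)`. -/
def jac {n : ℕ} (S : Sys n) (y : Fin n → ℝ) : Matrix (Fin n) (Fin n) ℝ :=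
  Matrix.of fun i l => (S i).jacRow y l

/-- `q` is the least fixed point of `x = P(x)` in `[0,1]^n`. -/
def IsLFP {n : ℕ} (isMax : Bool) (S : Sys n) (q : Fin n → ℝ) : Prop :=
  eval isMax S q = q ∧ (∀ i, 0 ≤ q i) ∧ (∀ i, q i ≤ 1) ∧
    (∀ q' : Fin n → ℝ, eval isMax S q' = q' → (∀ i, 0 ≤ q' i) → (∀ i, q' i ≤ 1) →
      ∀ i, q i ≤ q' i)

/-- Applying a policy `σ` (a choice, for each form-M equation `max/min {x_j, x_k}`,
of one of the two variables: `true` picks `x_j`, `false` picks `x_k`) to the system,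
yielding the PPS `x = P_σ(x)`. -/
def applyPolicy {n : ℕ} (S : Sys n) (σ : Fin n → Bool) : Sys n := fun i =>
  match S i with
  | .m j k => .lin 0 (fun l => if l = (if σ i then j else k) then 1 else 0)
  | e => e

/-- The linearization `P^y` of `P` at `y`: equations of form L and M are unchanged,
and a form-Q equation `x_j x_k` becomes `y_j x_k + x_j y_k - y_j y_k`. -/
def linEval {n : ℕ} (isMax : Bool) (S : Sys n) (y x : Fin n → ℝ) : Fin n → ℝ := fun i =>
  match S i with
  | .quad j k => y j * x k + x j * y k - y j * y k
  | e => e.eval isMax x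

/-- The Newton operator `N(y) = y + (I - P'(y))⁻¹ (P(y) - y)`. -/
noncomputable def newton {n : ℕ} (isMax : Bool) (S : Sys n) (y : Fin n → ℝ) : Fin n → ℝ :=
  y + (1 - jac S y)⁻¹ *ᵥ (eval isMax S y - y)

/-- the l∞ norm of a vector -/
noncomputable def vnorm {n : ℕ} (v : Fin n → ℝ) : ℝ := ⨆ i, |v i|

/-- the l∞ (max absolute row sum) norm of a matrix -/
noncomputable def mnorm {n : ℕ} (A : Matrix (Fin n) (Fin n) ℝ) : ℝ := ⨆ i, ∑ j, |A i j|

end PPS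

namespace PPS

namespace Eqn

/-- Every equation is monotone on the nonnegative orthant. -/
theorem eval_mono {n : ℕ} (b : Bool) {e : Eqn n} (he : e.Valid) {x y : Fin n → ℝ}
    (hx : ∀ i, 0 ≤ x i) (hxy : ∀ i, x i ≤ y i) : e.eval b x ≤ e.eval b y := by
  cases e with
  | lin a0 a =>
    obtain ⟨-, ha, -⟩ := he
    simp only [eval]
    gcongr with j
    · exact ha j
    · exact hxy j
  | quad j k =>
    exact mul_le_mul (hxy j) (hxy k) (hx k) ((hx j).trans (hxy j))
  | m j k =>
    cases b
    · exact min_le_min (hxy j) (hxy k)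
    · exact max_le_max (hxy j) (hxy k)

theorem eval_nonneg {n : ℕ} (b : Bool) {e : Eqn n} (he : e.Valid) {x : Fin n → ℝ}
    (hx : ∀ i, 0 ≤ x i) : 0 ≤ e.eval b x := by
  cases e with
  | lin a0 a =>
    exact add_nonneg he.1 (Finset.sum_nonneg fun j _ => mul_nonneg (he.2.1 j) (hx j))
  | quad j k => exact mul_nonneg (hx j) (hx k)
  | m j k => cases b <;> simp [eval, hx]

theorem jacRow_nonneg {n : ℕ} {e : Eqn n} (he : e.Valid) {y : Fin n → ℝ}
    (hy : ∀ i, 0 ≤ y i) (l : Fin n) : 0 ≤ e.jacRow y l := by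
  cases e with
  | lin a0 a => exact he.2.1 l
  | quad j k =>
    simp only [jacRow]
    have := hy j
    have := hy k
    split_ifs <;> linarith
  | m j k => exact le_rfl

theorem sum_jacRow_quad {n : ℕ} (j k : Fin n) (y u : Fin n → ℝ) :
    ∑ l, (quad j k).jacRow y l * u l = y k * u j + y j * u k := by
  simp [jacRow, add_mul, Finset.sum_add_distrib]

/-- For `0 ≤ y ≤ q < 1`, the derivative at `y` in the direction `1 - q` is strictly smaller
than `1 - P(q)` for a product equation. -/
theorem sum_jacRow_quad_lt {n : ℕ} (b : Bool) (j k : Fin n) {y q : Fin n → ℝ}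
    (hyq : ∀ i, y i ≤ q i) (h1 : ∀ i, q i < 1) :
    ∑ l, (quad j k).jacRow y l * (1 - q l) < 1 - (quad j k).eval b q := by
  rw [sum_jacRow_quad]
  simp only [eval]
  nlinarith [mul_pos (sub_pos.2 (h1 j)) (sub_pos.2 (h1 k)),
    mul_nonneg (sub_nonneg.2 (hyq j)) (sub_pos.2 (h1 k)).le,
    mul_nonneg (sub_nonneg.2 (hyq k)) (sub_pos.2 (h1 j)).le]

theorem sum_jacRow_lin {n : ℕ} (b : Bool) (a0 : ℝ) (a y q : Fin n → ℝ) :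
    ∑ l, (lin a0 a).jacRow y l * (1 - q l) =
      a0 + ∑ l, a l - (lin a0 a).eval b q := by
  simp only [jacRow, eval, mul_sub, mul_one, Finset.sum_sub_distrib]
  ring

theorem sum_jacRow_le {n : ℕ} (b : Bool) {e : Eqn n} (he : e.Valid) (hl : e.IsLinOrQuad)
    {y q : Fin n → ℝ} (hyq : ∀ i, y i ≤ q i) (h1 : ∀ i, q i < 1) :
    ∑ l, e.jacRow y l * (1 - q l) ≤ 1 - e.eval b q := by
  cases e with
  | lin a0 a =>
    rw [sum_jacRow_lin b]
    have := he.2.2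
    linarith
  | quad j k => exact (sum_jacRow_quad_lt b j k hyq h1).le
  | m j k => exact hl.elim

/-- The only equations attaining equality in `sum_jacRow_le` are linear ones whose
coefficients sum to `1`. -/
theorem eq_lin_of_le_sum_jacRow {n : ℕ} (b : Bool) {e : Eqn n} (he : e.Valid)
    (hl : e.IsLinOrQuad) {y q : Fin n → ℝ} (hyq : ∀ i, y i ≤ q i) (h1 : ∀ i, q i < 1)
    (h : 1 - e.eval b q ≤ ∑ l, e.jacRow y l * (1 - q l)) :
    ∃ a0 a, e = lin a0 a ∧ a0 + ∑ l, a l = 1 := by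
  cases e with
  | lin a0 a =>
    rw [sum_jacRow_lin b] at h
    have := he.2.2
    exact ⟨a0, a, rfl, by linarith⟩
  | quad j k => exact absurd h (sum_jacRow_quad_lt b j k hyq h1).not_ge
  | m j k => exact hl.elim

end Eqn

theorem sysValid_applyPolicy {n : ℕ} {S : Sys n} (hS : SysValid S) (σ : Fin n → Bool) :
    SysValid (applyPolicy S σ) := by
  intro i
  have := hS i
  unfold applyPolicy
  cases h : S i with
  | lin a0 a => simpa [h] using this
  | quad j k => trivial
  | m j k =>
    refine ⟨le_rfl, fun l => ?_, ?_⟩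
    · dsimp only
      split_ifs <;> norm_num
    · simp

theorem isPPS_applyPolicy {n : ℕ} (S : Sys n) (σ : Fin n → Bool) :
    IsPPS (applyPolicy S σ) := by
  intro i
  unfold applyPolicy
  cases S i <;> trivial

theorem eval_le_eval_applyPolicy {n : ℕ} (S : Sys n) (σ : Fin n → Bool) (x : Fin n → ℝ)
    (i : Fin n) : eval false S x i ≤ eval false (applyPolicy S σ) x i := by
  unfold eval applyPolicy
  cases S i with
  | lin a0 a => exact le_rfl
  | quad j k => exact le_rfl
  | m j k => cases σ i <;> simp [Eqn.eval]

/-- The least fixed point lies below every point of `[0,1]^n` with `P(x) ≤ x`. -/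
theorem IsLFP.le_of_eval_le {n : ℕ} {b : Bool} {S : Sys n} (hS : SysValid S)
    {q : Fin n → ℝ} (hq : IsLFP b S q) {x : Fin n → ℝ} (hx0 : ∀ i, 0 ≤ x i)
    (hx1 : ∀ i, x i ≤ 1) (hx : ∀ i, eval b S x i ≤ x i) (i : Fin n) : q i ≤ x i := by
  let T : Set (Fin n → ℝ) :=
    {x | (∀ i, 0 ≤ x i) ∧ (∀ i, x i ≤ 1) ∧ ∀ i, eval b S x i ≤ x i}
  let p : Fin n → ℝ := fun i => sInf ((fun x => x i) '' T)
  have hxT : x ∈ T := ⟨hx0, hx1, hx⟩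
  have hple : ∀ z ∈ T, ∀ i, p i ≤ z i := fun z hz i =>
    csInf_le ⟨0, by rintro _ ⟨w, hw, rfl⟩; exact hw.1 i⟩ ⟨z, hz, rfl⟩
  have hlep : ∀ i c, (∀ z ∈ T, c ≤ z i) → c ≤ p i := fun i c h =>
    le_csInf ⟨_, x, hxT, rfl⟩ (by rintro _ ⟨w, hw, rfl⟩; exact h w hw)
  have hp0 : ∀ i, 0 ≤ p i := fun i => hlep i 0 fun z hz => hz.1 i
  have hp1 : ∀ i, p i ≤ 1 := fun i => (hple x hxT i).trans (hx1 i)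
  have hPp : ∀ i, eval b S p i ≤ p i := fun i => hlep i _ fun z hz =>
    (Eqn.eval_mono b (hS i) hp0 (hple z hz)).trans (hz.2.2 i)
  have hPp0 : ∀ i, 0 ≤ eval b S p i := fun i => Eqn.eval_nonneg b (hS i) hp0
  have hPT : eval b S p ∈ T :=
    ⟨hPp0, fun i => (hPp i).trans (hp1 i), fun i => Eqn.eval_mono b (hS i) hPp0 hPp⟩
  have hfix : eval b S p = p := funext fun i => le_antisymm (hPp i) (hple _ hPT i)
  exact (hq.2.2.2 p hfix hp0 hp1 i).trans (hple x hxT i)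

/-- A square matrix `M` such that `0 ≤ M z` implies `0 ≤ z` is invertible with entrywise
nonnegative inverse. -/
theorem isUnit_and_inv_nonneg_of_monotone {ι : Type*} [Fintype ι] [DecidableEq ι]
    {M : Matrix ι ι ℝ} (hM : ∀ z : ι → ℝ, (∀ i, 0 ≤ (M *ᵥ z) i) → ∀ i, 0 ≤ z i) :
    IsUnit M ∧ ∀ i j, 0 ≤ M⁻¹ i j := by
  have hunit : IsUnit M := by
    rw [← Matrix.mulVec_injective_iff_isUnit]
    intro v w hvw
    have key : ∀ v w : ι → ℝ, M *ᵥ v = M *ᵥ w → ∀ i, w i ≤ v i := fun v w h i =>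
      sub_nonneg.1 (hM (v - w) (fun k => by simp [Matrix.mulVec_sub, h]) i)
    exact funext fun i => le_antisymm (key w v hvw.symm i) (key v w hvw i)
  refine ⟨hunit, fun i j => ?_⟩
  have h := hM (M⁻¹ *ᵥ Pi.single j 1) (fun k => ?_) i
  · simpa using h
  · rw [Matrix.mulVec_mulVec, Matrix.mul_nonsing_inv M ((Matrix.isUnit_iff_isUnit_det M).1 hunit),
      Matrix.one_mulVec]
    by_cases hk : k = j
    · subst hk; simp
    · simp [hk]

/-- If `A ≥ 0`, `u > 0`, `A u ≤ u`, and no nonempty set of indices closed under the nonzero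
entries of `A` satisfies `A u = u` throughout, then `1 - A` is a monotone matrix. -/
theorem nonneg_of_nonneg_one_sub_mulVec {ι : Type*} [Fintype ι] [DecidableEq ι]
    {A : Matrix ι ι ℝ} (hA : ∀ i j, 0 ≤ A i j) {u : ι → ℝ} (hu : ∀ i, 0 < u i)
    (hAu : ∀ i, (A *ᵥ u) i ≤ u i)
    (hD : ∀ D : Set ι, D.Nonempty → (∀ i ∈ D, (A *ᵥ u) i = u i) →
      ¬ ∀ i ∈ D, ∀ j, A i j ≠ 0 → j ∈ D)
    {z : ι → ℝ} (hz : ∀ i, 0 ≤ ((1 - A) *ᵥ z) i) (i : ι) : 0 ≤ z i := by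
  by_contra! hi
  have : Nonempty ι := ⟨i⟩
  obtain ⟨m, hm⟩ := Finite.exists_min fun i => z i / u i
  set t := z m / u m with ht
  have htneg : t < 0 := (hm i).trans_lt (div_neg_of_neg_of_pos hi (hu i))
  have htz : ∀ k, 0 ≤ z k - t * u k := fun k => sub_nonneg.2 ((le_div_iff₀ (hu k)).1 (hm k))
  have hsum : ∀ k, ∑ j, A k j * (z j - t * u j) = (A *ᵥ z) k - t * (A *ᵥ u) k := fun k => by
    simp only [Matrix.mulVec, dotProduct, mul_sub, Finset.sum_sub_distrib, Finset.mul_sum]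
    congr 1
    exact Finset.sum_congr rfl fun j _ => by ring
  have hpos : ∀ k j, 0 ≤ A k j * (z j - t * u j) := fun k j => mul_nonneg (hA k j) (htz j)
  have hz' : ∀ k, (A *ᵥ z) k ≤ z k := fun k => by
    simpa [Matrix.sub_mulVec] using hz k
  refine hD {k | z k - t * u k = 0} ⟨m, ?_⟩ ?_ ?_
  · change z m - z m / u m * u m = 0
    rw [div_mul_cancel₀ _ (hu m).ne', sub_self]
  · intro k hk
    have hk : z k - t * u k = 0 := hk
    have h1 : 0 ≤ (A *ᵥ z) k - t * (A *ᵥ u) k := hsum k ▸ Finset.sum_nonneg fun j _ => hpos k j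
    have h2 := hz' k
    refine le_antisymm (hAu k) ?_
    nlinarith
  · intro k hk j hkj
    have hk : z k - t * u k = 0 := hk
    have h0 : ∑ j, A k j * (z j - t * u j) = 0 := by
      refine le_antisymm ?_ (Finset.sum_nonneg fun j _ => hpos k j)
      rw [hsum]
      nlinarith [hz' k, hAu k]
    have := (Finset.sum_eq_zero_iff_of_nonneg fun j _ => hpos k j).1 h0 j (Finset.mem_univ j)
    exact (mul_eq_zero.1 this).resolve_left hkj

/-- If the least fixed point of a minPPS is positive, then no policy admits a nonempty set of
variables whose equations are linear with zero constant term and only involve variables of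
the set. -/
theorem IsLFP.not_closed_of_pos {n : ℕ} {S : Sys n} (hS : SysValid S) {q : Fin n → ℝ}
    (hq : IsLFP false S q) (h0 : ∀ i, 0 < q i) (σ : Fin n → Bool) {E : Set (Fin n)}
    (hE : E.Nonempty) :
    ¬ ∀ i ∈ E, ∃ a, applyPolicy S σ i = .lin 0 a ∧ ∀ j, a j ≠ 0 → j ∈ E := by
  classical
  intro h
  let x : Fin n → ℝ := fun i => if i ∈ E then 0 else q i
  have hx0 : ∀ i, 0 ≤ x i := fun i => by
    dsimp only [x]; split_ifs
    · exact le_rfl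
    · exact (h0 i).le
  have hxq : ∀ i, x i ≤ q i := fun i => by
    dsimp only [x]; split_ifs
    · exact (h0 i).le
    · exact le_rfl
  have hx : ∀ i, eval false S x i ≤ x i := fun i => by
    by_cases hi : i ∈ E
    · obtain ⟨a, ha, hcl⟩ := h i hi
      refine (eval_le_eval_applyPolicy S σ x i).trans (le_of_eq ?_)
      simp only [eval, ha, Eqn.eval, zero_add]
      rw [show x i = 0 from if_pos hi]
      refine Finset.sum_eq_zero fun j _ => ?_
      by_cases haj : a j = 0
      · simp [haj]
      · simp [x, hcl j haj]
    · calc eval false S x i ≤ eval false S q i := Eqn.eval_mono false (hS i) hx0 hxq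
        _ = x i := by rw [hq.1]; exact (if_neg hi).symm
  obtain ⟨i, hi⟩ := hE
  have hle := hq.le_of_eval_le hS hx0 (fun i => (hxq i).trans (hq.2.2.1 i)) hx i
  rw [show x i = 0 from if_pos hi] at hle
  exact (h0 i).not_ge hle

end PPS

open PPS in
/-- Let `x = P(x)` be a minPPS in SNF with LFP `0 < q* < 1`.  For any `0 ≤ y ≤ q*` and
any policy `σ`, the matrix `(I - P'_σ(y))⁻¹` exists and is entrywise nonnegative;
hence the Newton iterate `N_σ(y)` is defined. -/
theorem stmt7 {n : ℕ} (S : Sys n) (hval : SysValid S)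
    (q : Fin n → ℝ) (hq : IsLFP false S q) (h0 : ∀ i, 0 < q i) (h1 : ∀ i, q i < 1)
    (y : Fin n → ℝ) (hy0 : ∀ i, 0 ≤ y i) (hyq : ∀ i, y i ≤ q i)
    (σ : Fin n → Bool) :
    IsUnit (1 - jac (applyPolicy S σ) y) ∧
    (∀ i j, 0 ≤ ((1 - jac (applyPolicy S σ) y)⁻¹) i j) := by
  have hT := sysValid_applyPolicy hval σ
  have hL := isPPS_applyPolicy S σ
  set T := applyPolicy S σ
  have hu : ∀ i, 0 < 1 - q i := fun i => sub_pos.2 (h1 i)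
  have hTq : ∀ i, 1 - (T i).eval false q ≤ 1 - q i := fun i => by
    have h : eval false S q i ≤ (T i).eval false q := eval_le_eval_applyPolicy S σ q i
    rw [hq.1] at h
    linarith
  refine isUnit_and_inv_nonneg_of_monotone fun z hz =>
    nonneg_of_nonneg_one_sub_mulVec (fun i j => Eqn.jacRow_nonneg (hT i) hy0 j) hu
      (fun i => (Eqn.sum_jacRow_le false (hT i) (hL i) hyq h1).trans (hTq i)) ?_ hz
  intro D hDne hDeq hDcl
  obtain ⟨m, hmD, hm⟩ := D.toFinite.exists_maximalFor (fun i => 1 - q i) D hDne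
  have hmax : ∀ j ∈ D, 1 - q j ≤ 1 - q m := fun j hj =>
    (le_total (1 - q j) (1 - q m)).elim id (hm hj)
  refine hq.not_closed_of_pos hval h0 σ (E := {i | i ∈ D ∧ q i = q m}) ⟨m, hmD, rfl⟩ ?_
  rintro i ⟨hiD, him⟩
  have hi : ∑ l, (T i).jacRow y l * (1 - q l) = 1 - q i := hDeq i hiD
  obtain ⟨a0, a, hlin, hsum⟩ := Eqn.eq_lin_of_le_sum_jacRow false (hT i) (hL i) hyq h1
    ((hTq i).trans hi.ge)
  have hcl : ∀ j, a j ≠ 0 → j ∈ D := fun j hj =>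
    hDcl i hiD j (by simpa [jac, hlin, Eqn.jacRow] using hj)
  have hval' := hT i
  rw [hlin] at hi hval'
  obtain ⟨ha0, ha, -⟩ := hval'
  simp only [Eqn.jacRow] at hi
  have hterm : ∀ j, 0 ≤ a j * (q j - q i) := fun j => by
    by_cases hj : a j = 0
    · simp [hj]
    · have := hmax j (hcl j hj)
      exact mul_nonneg (ha j) (by linarith)
  have hexp : ∑ j, a j * (q j - q i) = -(a0 * (1 - q i)) := by
    have : ∑ j, a j * (q j - q i) = (∑ j, a j) * (1 - q i) - ∑ j, a j * (1 - q j) := by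
      rw [Finset.sum_mul, ← Finset.sum_sub_distrib]
      exact Finset.sum_congr rfl fun j _ => by ring
    rw [this, hi, eq_sub_of_add_eq' hsum]
    ring
  have hnn := Finset.sum_nonneg fun j (_ : j ∈ Finset.univ) => hterm j
  have ha0' : a0 = 0 := by nlinarith [hu i]
  subst ha0'
  refine ⟨a, hlin, fun j hj => ⟨hcl j hj, ?_⟩⟩
  have := (Finset.sum_eq_zero_iff_of_nonneg fun j _ => hterm j).1 (by simpa using hexp) j
    (Finset.mem_univ j)
  rw [← him]
  exact sub_eq_zero.1 ((mul_eq_zero.1 this).resolve_left hj)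
end

section
/- Let x = P(x) be a minPPS in SNF with least fixed point q* satisfying 0 < q* < 1, and let 0 ≤ y ≤ q*. Then among all vectors a ∈ ℝ^n satisfying P^y(a) ≥ a there is a unique one maximizing Σ_i a_i; calling it I(y), there exists a policy σ such that I(y) = N_σ(y), and moreover P^y(I(y)) = I(y). -/
open Matrix Finset

namespace PPS

variable {n : ℕ}

/-- A monotone self-map of `ℝ^n` whose post-fixed points are bounded above, and which has at
least one of them, has a greatest post-fixed point; it is a fixed point. -/
theorem exists_greatest_postfixed {F : (Fin n → ℝ) → Fin n → ℝ} (hF : Monotone F)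
    {a₀ b : Fin n → ℝ} (h₀ : a₀ ≤ F a₀) (hb : ∀ a, a ≤ F a → a ≤ b) :
    ∃ g, F g = g ∧ ∀ a, a ≤ F a → a ≤ g := by
  have hbdd : BddAbove {a | a ≤ F a} := ⟨b, hb⟩
  have hle : ∀ a, a ≤ F a → a ≤ sSup {a | a ≤ F a} := fun a ha => le_csSup hbdd ha
  have hpost : sSup {a | a ≤ F a} ≤ F (sSup {a | a ≤ F a}) :=
    csSup_le ⟨a₀, h₀⟩ fun a ha => le_trans ha (hF (hle a ha))
  exact ⟨_, le_antisymm (hle _ (hF hpost)) hpost, hle⟩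

/-- If `x ≤ A x` forces `x ≤ 0`, then `1 - A` is invertible. -/
theorem isUnit_one_sub_of_subinvariant {A : Matrix (Fin n) (Fin n) ℝ}
    (hA : ∀ x : Fin n → ℝ, x ≤ A *ᵥ x → x ≤ 0) : IsUnit (1 - A) := by
  rw [← Matrix.mulVec_injective_iff_isUnit]
  intro u v huv
  have h : A *ᵥ (u - v) = u - v := by
    have h' : (1 - A) *ᵥ (u - v) = 0 := by
      rw [Matrix.mulVec_sub]; exact sub_eq_zero.mpr huv
    rw [Matrix.sub_mulVec, Matrix.one_mulVec] at h'
    exact (sub_eq_zero.mp h').symm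
  have h₁ := hA (u - v) h.ge
  have h₂ := hA (v - u) (by rw [← neg_sub u v, Matrix.mulVec_neg, h])
  exact le_antisymm (sub_nonpos.mp h₁) (sub_nonpos.mp h₂)

theorem mulVec_mono {A : Matrix (Fin n) (Fin n) ℝ} (hA : ∀ i j, 0 ≤ A i j)
    {u v : Fin n → ℝ} (h : u ≤ v) : A *ᵥ u ≤ A *ᵥ v := by
  intro i
  simp only [Matrix.mulVec, dotProduct]
  exact Finset.sum_le_sum fun j _ => mul_le_mul_of_nonneg_left (h j) (hA i j)

/-- A positive multiple of `v` dominates `x` and touches it at some index,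
if `v` is positive and `x` has a positive coordinate. -/
theorem exists_touching_multiple {v x : Fin n → ℝ} (hv : ∀ i, 0 < v i)
    {i₀ : Fin n} (hx : 0 < x i₀) :
    ∃ s : ℝ, 0 < s ∧ (∀ i, x i ≤ s * v i) ∧ ∃ i, x i = s * v i := by
  obtain ⟨i, -, hi⟩ := Finset.exists_max_image Finset.univ (fun i => x i / v i) ⟨i₀, by simp⟩
  refine ⟨x i / v i, (div_pos hx (hv i₀)).trans_le (hi i₀ (by simp)), fun j => ?_, i, ?_⟩
  · exact (div_le_iff₀ (hv j)).mp (hi j (by simp))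
  · exact (div_mul_cancel₀ _ (hv i).ne').symm

/-- A nonnegative matrix that strictly decreases some positive vector admits only
nonpositive subinvariant vectors. -/
theorem nonpos_of_le_mulVec {A : Matrix (Fin n) (Fin n) ℝ} (hA : ∀ i j, 0 ≤ A i j)
    {v : Fin n → ℝ} (hv : ∀ i, 0 < v i) (hAv : ∀ i, (A *ᵥ v) i < v i)
    {x : Fin n → ℝ} (hx : x ≤ A *ᵥ x) : x ≤ 0 := by
  intro i₀
  by_contra! hpos
  obtain ⟨s, hs, hle, i, hi⟩ := exists_touching_multiple hv hpos
  have h₁ : (A *ᵥ x) i ≤ (A *ᵥ (s • v)) i := mulVec_mono hA hle i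
  rw [Matrix.mulVec_smul] at h₁
  have h₂ := mul_lt_mul_of_pos_left (hAv i) hs
  have h₃ := hx i
  simp only [Pi.smul_apply, smul_eq_mul] at h₁
  linarith

section System

variable {S : Sys n} {y : Fin n → ℝ}

theorem eval_mono (hval : SysValid S) {u v : Fin n → ℝ} (hu : 0 ≤ u) (h : u ≤ v) :
    eval false S u ≤ eval false S v := by
  intro i
  have hi := hval i
  simp only [eval]
  cases hS : S i with
  | lin a0 a =>
    rw [hS] at hi
    have := Finset.sum_le_sum fun j (_ : j ∈ Finset.univ) =>
      mul_le_mul_of_nonneg_left (h j) (hi.2.1 j)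
    simpa [Eqn.eval] using this
  | quad j k => exact mul_le_mul (h j) (h k) (hu k) ((hu j).trans (h j))
  | m j k => simpa [Eqn.eval] using
      (min_le_min (h j) (h k) : min (u j) (u k) ≤ min (v j) (v k))

theorem linEval_mono (hval : SysValid S) (hy : 0 ≤ y) : Monotone (linEval false S y) := by
  intro u v h i
  have hi := hval i
  simp only [linEval]
  cases hS : S i with
  | lin a0 a =>
    rw [hS] at hi
    have := Finset.sum_le_sum fun j (_ : j ∈ Finset.univ) =>
      mul_le_mul_of_nonneg_left (h j) (hi.2.1 j)
    simpa [Eqn.eval] using this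
  | quad j k =>
    have h₁ := mul_le_mul_of_nonneg_left (h k) (hy j)
    have h₂ := mul_le_mul_of_nonneg_right (h j) (hy k)
    dsimp only
    linarith
  | m j k => simpa [Eqn.eval] using
      (min_le_min (h j) (h k) : min (u j) (u k) ≤ min (v j) (v k))

theorem continuous_linEval : Continuous (linEval false S y) := by
  refine continuous_pi fun i => ?_
  simp only [linEval]
  cases hS : S i with
  | lin a0 a => simp only [Eqn.eval]; fun_prop
  | quad j k => fun_prop
  | m j k => simp only [Eqn.eval, Bool.false_eq_true, if_false]; fun_prop

theorem jac_applyPolicy_nonneg (hval : SysValid S) (hy : 0 ≤ y) (σ : Fin n → Bool)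
    (i l : Fin n) : 0 ≤ jac (applyPolicy S σ) y i l := by
  have hi := hval i
  simp only [jac, Matrix.of_apply, applyPolicy]
  cases hS : S i with
  | lin a0 a => rw [hS] at hi; exact hi.2.1 l
  | quad j k =>
    have hj := hy j
    have hk := hy k
    simp only [Pi.zero_apply] at hj hk
    simp only [Eqn.jacRow]
    split_ifs <;> positivity
  | m j k => simp only [Eqn.jacRow]; split_ifs <;> norm_num

/-- The affine map linearizing `P_σ` at `y`. -/
def policyLin (S : Sys n) (σ : Fin n → Bool) (y x : Fin n → ℝ) : Fin n → ℝ :=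
  eval false (applyPolicy S σ) y + jac (applyPolicy S σ) y *ᵥ (x - y)

theorem jac_mulVec_lin {σ : Fin n → Bool} {i : Fin n} {a0 : ℝ} {a : Fin n → ℝ}
    (hS : S i = .lin a0 a) (x : Fin n → ℝ) :
    (jac (applyPolicy S σ) y *ᵥ x) i = ∑ l, a l * x l := by
  simp [Matrix.mulVec, dotProduct, jac, applyPolicy, hS, Eqn.jacRow]

theorem jac_mulVec_quad {σ : Fin n → Bool} {i j k : Fin n}
    (hS : S i = .quad j k) (x : Fin n → ℝ) :
    (jac (applyPolicy S σ) y *ᵥ x) i = y k * x j + y j * x k := by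
  simp [Matrix.mulVec, dotProduct, jac, applyPolicy, hS, Eqn.jacRow, add_mul,
    Finset.sum_add_distrib]

theorem jac_mulVec_m {σ : Fin n → Bool} {i j k : Fin n}
    (hS : S i = .m j k) (x : Fin n → ℝ) :
    (jac (applyPolicy S σ) y *ᵥ x) i = x (if σ i then j else k) := by
  simp [Matrix.mulVec, dotProduct, jac, applyPolicy, hS, Eqn.jacRow]

theorem policyLin_lin {σ : Fin n → Bool} {i : Fin n} {a0 : ℝ} {a : Fin n → ℝ}
    (hS : S i = .lin a0 a) (x : Fin n → ℝ) :
    policyLin S σ y x i = a0 + ∑ l, a l * x l := by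
  simp only [policyLin, Pi.add_apply, jac_mulVec_lin hS]
  simp [eval, applyPolicy, hS, Eqn.eval, mul_sub]

theorem policyLin_quad {σ : Fin n → Bool} {i j k : Fin n}
    (hS : S i = .quad j k) (x : Fin n → ℝ) :
    policyLin S σ y x i = y j * x k + x j * y k - y j * y k := by
  simp only [policyLin, Pi.add_apply, jac_mulVec_quad hS]
  simp only [eval, applyPolicy, hS, Eqn.eval, Pi.sub_apply]
  ring

theorem policyLin_m {σ : Fin n → Bool} {i j k : Fin n}
    (hS : S i = .m j k) (x : Fin n → ℝ) :
    policyLin S σ y x i = x (if σ i then j else k) := by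
  simp only [policyLin, Pi.add_apply, jac_mulVec_m hS]
  simp [eval, applyPolicy, hS, Eqn.eval]

theorem linEval_le_policyLin (σ : Fin n → Bool) (x : Fin n → ℝ) :
    linEval false S y x ≤ policyLin S σ y x := by
  intro i
  cases hS : S i with
  | lin a0 a => rw [policyLin_lin hS]; simp [linEval, hS, Eqn.eval]
  | quad j k => rw [policyLin_quad hS]; simp [linEval, hS]
  | m j k =>
    rw [policyLin_m hS]
    cases σ i <;> simp [linEval, hS, Eqn.eval]

/-- The policy choosing, in each form-M equation, a variable that is smallest at `x`. -/
noncomputable def greedy (S : Sys n) (x : Fin n → ℝ) : Fin n → Bool := fun i =>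
  match S i with
  | .m j k => decide (x j ≤ x k)
  | _ => true

theorem apply_greedy {i j k : Fin n} (hS : S i = .m j k) (x : Fin n → ℝ) :
    x (if greedy S x i then j else k) = min (x j) (x k) := by
  simp only [greedy, hS, decide_eq_true_eq]
  split_ifs with h
  · exact (min_eq_left h).symm
  · exact (min_eq_right (le_of_not_ge h)).symm

theorem policyLin_greedy (x : Fin n → ℝ) :
    policyLin S (greedy S x) y x = linEval false S y x := by
  funext i
  cases hS : S i with
  | lin a0 a => rw [policyLin_lin hS]; simp [linEval, hS, Eqn.eval]
  | quad j k => rw [policyLin_quad hS]; simp [linEval, hS]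
  | m j k => rw [policyLin_m hS, apply_greedy hS x]; simp [linEval, hS, Eqn.eval]

theorem policyLin_sub (σ : Fin n → Bool) (u v : Fin n → ℝ) :
    policyLin S σ y u - policyLin S σ y v = jac (applyPolicy S σ) y *ᵥ (u - v) := by
  simp only [policyLin, add_sub_add_left_eq_sub, ← Matrix.mulVec_sub, sub_sub_sub_cancel_right]

theorem continuous_policyLin (σ : Fin n → Bool) : Continuous (policyLin S σ y) := by
  unfold policyLin
  fun_prop

theorem eq_newton_of_policyLin_eq {σ : Fin n → Bool} {g : Fin n → ℝ}
    (hU : IsUnit (1 - jac (applyPolicy S σ) y)) (hg : policyLin S σ y g = g) :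
    g = newton false (applyPolicy S σ) y := by
  have h : eval false (applyPolicy S σ) y - y
      = (1 - jac (applyPolicy S σ) y) *ᵥ (g - y) := by
    have hg' : eval false (applyPolicy S σ) y + jac (applyPolicy S σ) y *ᵥ (g - y) = g := hg
    rw [Matrix.sub_mulVec, Matrix.one_mulVec, eq_sub_iff_add_eq, sub_add_eq_add_sub, hg']
  rw [newton, h, Matrix.mulVec_mulVec,
    Matrix.nonsing_inv_mul _ ((Matrix.isUnit_iff_isUnit_det _).mp hU), Matrix.one_mulVec]
  abel

variable {q : Fin n → ℝ}

/-- The least fixed point lies below every nonnegative pre-fixed point bounded by `1`. -/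
theorem IsLFP.le_of_eval_le_s10 (hq : IsLFP false S q) (hval : SysValid S) {r : Fin n → ℝ}
    (hr0 : 0 ≤ r) (hr1 : ∀ i, r i ≤ 1) (hr : eval false S r ≤ r) : q ≤ r := by
  have hP0 : ∀ x : Fin n → ℝ, 0 ≤ x → 0 ≤ eval false S x := by
    intro x hx i
    have hi := hval i
    simp only [eval, Pi.zero_apply]
    cases hS : S i with
    | lin a0 a =>
      rw [hS] at hi
      exact add_nonneg hi.1 (Finset.sum_nonneg fun j _ => mul_nonneg (hi.2.1 j) (hx j))
    | quad j k => exact mul_nonneg (hx j) (hx k)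
    | m j k => simpa [Eqn.eval] using And.intro (hx j) (hx k)
  obtain ⟨g, hg, hmax⟩ := exists_greatest_postfixed
    (F := fun x => eval false S (x ⊔ 0) ⊓ r) (a₀ := 0) (b := r)
    (fun u v h => inf_le_inf_right _ (eval_mono hval le_sup_right (sup_le_sup_right h _)))
    (le_inf (hP0 _ le_sup_right) hr0) (fun a ha => ha.trans inf_le_right)
  have hg0 : 0 ≤ g := hmax 0 (le_inf (hP0 _ le_sup_right) hr0)
  have hgr : g ≤ r := hg.symm.le.trans inf_le_right
  have hfix : eval false S g = g := by
    have h : eval false S g ⊓ r = g := by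
      simpa only [sup_eq_left.mpr hg0] using hg
    rwa [inf_eq_left.mpr ((eval_mono hval hg0 hgr).trans hr)] at h
  exact fun i => (hq.2.2.2 g hfix hg0 (fun j => (hgr j).trans (hr1 j)) i).trans (hgr i)

/-- The complement `1 - q` of a fixed point is superinvariant for the Jacobian of the policy
greedy at `q`, strictly so at form-Q equations. -/
theorem jac_greedy_mulVec_one_sub_le (hval : SysValid S) (hfix : eval false S q = q)
    (h1 : ∀ i, q i < 1) (hyq : y ≤ q) (i : Fin n) :
    (jac (applyPolicy S (greedy S q)) y *ᵥ (1 - q)) i ≤ (1 - q) i ∧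
      ∀ j k, S i = .quad j k →
        (jac (applyPolicy S (greedy S q)) y *ᵥ (1 - q)) i < (1 - q) i := by
  have hi := hval i
  have hqi := congrFun hfix i
  cases hS : S i with
  | lin a0 a =>
    rw [hS] at hi
    simp only [eval, hS, Eqn.eval] at hqi
    refine ⟨?_, by simp⟩
    rw [jac_mulVec_lin hS]
    simp only [Pi.sub_apply, Pi.one_apply, mul_sub, mul_one, Finset.sum_sub_distrib]
    linarith [hi.2.2]
  | quad j k =>
    simp only [eval, hS, Eqn.eval] at hqi
    have h : (jac (applyPolicy S (greedy S q)) y *ᵥ (1 - q)) i < (1 - q) i := by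
      rw [jac_mulVec_quad hS]
      simp only [Pi.sub_apply, Pi.one_apply]
      nlinarith [mul_pos (sub_pos.mpr (h1 j)) (sub_pos.mpr (h1 k)),
        mul_nonneg (sub_nonneg.mpr (hyq k)) (sub_pos.mpr (h1 j)).le,
        mul_nonneg (sub_nonneg.mpr (hyq j)) (sub_pos.mpr (h1 k)).le]
    exact ⟨h.le, fun _ _ _ => h⟩
  | m j k =>
    simp only [eval, hS, Eqn.eval, Bool.false_eq_true, if_false] at hqi
    refine ⟨?_, by simp⟩
    rw [jac_mulVec_m hS]
    simp only [Pi.sub_apply, Pi.one_apply, apply_greedy hS, hqi, le_refl]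

/-- The policy greedy at the least fixed point has a Jacobian without nontrivial
nonnegative subinvariant vectors. -/
theorem IsLFP.nonpos_of_le_jac_greedy_mulVec (hq : IsLFP false S q) (hval : SysValid S)
    (h0 : ∀ i, 0 < q i) (h1 : ∀ i, q i < 1) (hy0 : 0 ≤ y) (hyq : y ≤ q) {x : Fin n → ℝ}
    (hx : x ≤ jac (applyPolicy S (greedy S q)) y *ᵥ x) : x ≤ 0 := by
  set A := jac (applyPolicy S (greedy S q)) y with hAdef
  have hA : ∀ i j, 0 ≤ A i j := jac_applyPolicy_nonneg hval hy0 _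
  have hw : ∀ i, 0 < (1 - q) i := fun i => sub_pos.mpr (h1 i)
  intro i₀
  by_contra! hpos
  obtain ⟨s, hs, hle, i₁, hi₁⟩ := exists_touching_multiple hw hpos
  -- the vector agreeing with `1 - q` where `s • (1 - q)` touches `x`
  let d : Fin n → ℝ := fun i => if x i = s * (1 - q) i then (1 - q) i else 0
  have hd0 : 0 ≤ d := fun i => by
    simp only [d]; split_ifs
    · exact (hw i).le
    · exact le_rfl
  have hAw : ∀ i, x i = s * (1 - q) i → (A *ᵥ (1 - q)) i = (1 - q) i ∧
      (A *ᵥ d) i = (1 - q) i := by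
    intro i hi
    have hsum : (A *ᵥ x) i ≤ s * (A *ᵥ (1 - q)) i := by
      have := mulVec_mono hA (v := s • (1 - q)) hle i
      rwa [Matrix.mulVec_smul] at this
    have hwi := (jac_greedy_mulVec_one_sub_le hval hq.1 h1 hyq i).1
    have hge : s * (1 - q) i ≤ s * (A *ᵥ (1 - q)) i := by
      rw [← hi]; exact (hx i).trans hsum
    have heq : (A *ᵥ (1 - q)) i = (1 - q) i :=
      le_antisymm hwi (le_of_mul_le_mul_left hge hs)
    refine ⟨heq, ?_⟩
    have hterm : ∀ j ∈ Finset.univ, A i j * x j ≤ A i j * (s * (1 - q) j) :=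
      fun j _ => mul_le_mul_of_nonneg_left (hle j) (hA i j)
    have htot : ∑ j, A i j * x j = ∑ j, A i j * (s * (1 - q) j) := by
      refine le_antisymm (Finset.sum_le_sum hterm) ?_
      have h₁ : ∑ j, A i j * (s * (1 - q) j) = s * (A *ᵥ (1 - q)) i := by
        simp only [Matrix.mulVec, dotProduct, Finset.mul_sum]
        exact Finset.sum_congr rfl fun j _ => by ring
      rw [h₁, heq, ← hi]
      exact hx i
    have heach := (Finset.sum_eq_sum_iff_of_le hterm).mp htot
    rw [← heq]
    simp only [Matrix.mulVec, dotProduct]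
    refine Finset.sum_congr rfl fun j hj => ?_
    rcases mul_eq_mul_left_iff.mp (heach j hj) with h | h
    · simp only [d, if_pos h]
    · simp only [h, zero_mul]
  obtain ⟨t, ht, htq⟩ : ∃ t : ℝ, 0 < t ∧ ∀ i, t * d i ≤ q i := by
    obtain ⟨i, -, hi⟩ := Finset.exists_min_image Finset.univ q ⟨i₀, by simp⟩
    refine ⟨q i, h0 i, fun j => ?_⟩
    have hd1 : d j ≤ 1 := by
      simp only [d]; split_ifs
      · simp only [Pi.sub_apply, Pi.one_apply]; linarith [h0 j]
      · exact zero_le_one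
    nlinarith [hi j (by simp), h0 i]
  have hr0 : 0 ≤ q - t • d := fun i => sub_nonneg.mpr (htq i)
  have hrq : q - t • d ≤ q := sub_le_self _ (smul_nonneg ht.le hd0)
  have hr : eval false S (q - t • d) ≤ q - t • d := by
    intro i
    by_cases hi : x i = s * (1 - q) i
    · obtain ⟨heq, hdi⟩ := hAw i hi
      have hval_d : d i = (1 - q) i := if_pos hi
      have hqi := congrFun hq.1 i
      rw [← hval_d] at hdi
      cases hS : S i with
      | lin a0 a =>
        rw [hAdef, jac_mulVec_lin hS] at hdi
        simp only [eval, hS, Eqn.eval] at hqi ⊢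
        simp only [Pi.sub_apply, Pi.smul_apply, smul_eq_mul, mul_sub, Finset.sum_sub_distrib,
          mul_left_comm _ t, ← Finset.mul_sum, hdi]
        linarith
      | quad j k =>
        exact absurd heq ((jac_greedy_mulVec_one_sub_le hval hq.1 h1 hyq i).2 j k hS).ne
      | m j k =>
        rw [hAdef, jac_mulVec_m hS] at hdi
        have hsel := apply_greedy hS q
        simp only [eval, hS, Eqn.eval, Bool.false_eq_true, if_false] at hqi ⊢
        have hmin : min ((q - t • d) j) ((q - t • d) k)
            ≤ (q - t • d) (if greedy S q i then j else k) := by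
          cases greedy S q i <;> simp
        refine hmin.trans (le_of_eq ?_)
        simp only [Pi.sub_apply, Pi.smul_apply, hdi, hsel, hqi]
    · have hdi : d i = 0 := if_neg hi
      have := eval_mono hval hr0 hrq i
      rw [hq.1] at this
      simpa [hdi] using this
  have hfinal := hq.le_of_eval_le_s10 hval hr0 (fun i => (hrq i).trans (h1 i).le) hr i₁
  have hd₁ : d i₁ = (1 - q) i₁ := if_pos hi₁
  simp only [Pi.sub_apply, Pi.smul_apply, smul_eq_mul] at hfinal
  have := mul_pos ht (hw i₁)
  rw [← hd₁] at this
  linarith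

/-- The linearized system has a post-fixed point on the ray from `1` through `q`. -/
theorem exists_le_linEval (hval : SysValid S) (hfix : eval false S q = q)
    (h0 : ∀ i, 0 < q i) (h1 : ∀ i, q i < 1) (hy0 : 0 ≤ y) (hyq : y ≤ q) :
    ∃ a, a ≤ linEval false S y a := by
  obtain ⟨t, ht0, ht⟩ : ∃ t : ℝ, 0 ≤ t ∧ ∀ j k, q j * q k ≤ t * ((1 - q j) * (1 - q k)) := by
    have hpos : ∀ j k, 0 < (1 - q j) * (1 - q k) := fun j k =>
      mul_pos (sub_pos.mpr (h1 j)) (sub_pos.mpr (h1 k))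
    have hnn : ∀ j k, 0 ≤ q j * q k / ((1 - q j) * (1 - q k)) := fun j k =>
      div_nonneg (mul_pos (h0 j) (h0 k)).le (hpos j k).le
    refine ⟨∑ j, ∑ k, q j * q k / ((1 - q j) * (1 - q k)),
      Finset.sum_nonneg fun j _ => Finset.sum_nonneg fun k _ => hnn j k, fun j k => ?_⟩
    rw [← div_le_iff₀ (hpos j k)]
    exact (Finset.single_le_sum (fun k _ => hnn j k) (Finset.mem_univ k)).trans
      (Finset.single_le_sum (f := fun j => ∑ k, q j * q k / ((1 - q j) * (1 - q k)))
        (fun j _ => Finset.sum_nonneg fun k _ => hnn j k) (Finset.mem_univ j))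
  refine ⟨fun i => (1 + t) * q i - t, fun i => ?_⟩
  have hi := hval i
  have hqi := congrFun hfix i
  simp only [linEval]
  cases hS : S i with
  | lin a0 a =>
    rw [hS] at hi
    simp only [eval, hS, Eqn.eval] at hqi ⊢
    simp only [mul_sub, Finset.sum_sub_distrib, mul_left_comm _ (1 + t), ← Finset.mul_sum,
      ← Finset.sum_mul]
    nlinarith [mul_le_mul_of_nonneg_left hi.2.2 ht0]
  | quad j k =>
    simp only [eval, hS, Eqn.eval] at hqi
    have hwj := sub_pos.mpr (h1 j)
    have hwk := sub_pos.mpr (h1 k)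
    have hj := sub_nonneg.mpr (hyq j)
    have hk := sub_nonneg.mpr (hyq k)
    have e₁ := mul_nonneg ht0 (mul_nonneg hj hwk.le)
    have e₂ := mul_nonneg ht0 (mul_nonneg hk hwj.le)
    have e₃ : (q j - y j) * (q k - y k) ≤ q j * q k :=
      mul_le_mul (sub_le_self _ (hy0 j)) (sub_le_self _ (hy0 k)) hk (h0 j).le
    dsimp only
    rw [← hqi]
    linarith [ht j k]
  | m j k =>
    simp only [eval, hS, Eqn.eval, Bool.false_eq_true, if_false] at hqi ⊢
    rw [← hqi]
    have h : (0 : ℝ) ≤ 1 + t := by linarith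
    rw [mul_min_of_nonneg _ _ h, min_sub_sub_right]

/-- The perturbed linearized system `x = P^y(x) + ε` has a greatest post-fixed point. -/
theorem IsLFP.exists_greatest_linEval_add (hq : IsLFP false S q) (hval : SysValid S)
    (h0 : ∀ i, 0 < q i) (h1 : ∀ i, q i < 1) (hy0 : 0 ≤ y) (hyq : y ≤ q) {ε : Fin n → ℝ}
    (hε : 0 ≤ ε) :
    ∃ g, linEval false S y g + ε = g ∧ ∀ a, a ≤ linEval false S y a + ε → a ≤ g := by
  have hsub : ∀ x : Fin n → ℝ, x ≤ jac (applyPolicy S (greedy S q)) y *ᵥ x → x ≤ 0 :=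
    fun x hx => hq.nonpos_of_le_jac_greedy_mulVec hval h0 h1 hy0 hyq hx
  obtain ⟨a₀, ha₀⟩ := exists_le_linEval hval hq.1 h0 h1 hy0 hyq
  obtain ⟨z, hz⟩ := Matrix.mulVec_surjective_iff_isUnit.mpr
    (isUnit_one_sub_of_subinvariant hsub) (policyLin S (greedy S q) y 0 + ε)
  refine exists_greatest_postfixed (F := fun x => linEval false S y x + ε)
    (fun u v h => add_le_add_left (linEval_mono hval hy0 h) ε)
    (ha₀.trans (le_add_of_nonneg_right hε)) (b := z) fun a ha => ?_
  rw [← sub_nonpos]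
  refine hsub _ ?_
  have h₁ : a ≤ policyLin S (greedy S q) y a + ε :=
    ha.trans (add_le_add_left (linEval_le_policyLin _ a) ε)
  have h₂ := policyLin_sub (S := S) (y := y) (greedy S q) a 0
  rw [Matrix.sub_mulVec, Matrix.one_mulVec] at hz
  rw [sub_zero] at h₂
  rw [Matrix.mulVec_sub, ← h₂]
  intro i
  have e₁ := h₁ i
  have e₂ := congrFun hz i
  simp only [Pi.add_apply, Pi.sub_apply] at *
  linarith

end System

end PPS

open Filter Topology PPS in
/-- A greatest fixed point of the linearized system is attained by a policy whose Jacobian is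
nonsingular: policies greedy for slightly perturbed systems will do. -/
theorem PPS.exists_policy_of_greatest {n : ℕ} {S : Sys n} {y g : Fin n → ℝ} (hval : SysValid S)
    (hy0 : 0 ≤ y)
    (hpert : ∀ ε : Fin n → ℝ, 0 ≤ ε →
      ∃ h, linEval false S y h + ε = h ∧ ∀ a, a ≤ linEval false S y a + ε → a ≤ h)
    (hg : linEval false S y g = g) (hmax : ∀ a, a ≤ linEval false S y a → a ≤ g) :
    ∃ σ : Fin n → Bool, IsUnit (1 - jac (applyPolicy S σ) y) ∧ policyLin S σ y g = g := by
  let ε : ℕ → Fin n → ℝ := fun m _ => 1 / ((m : ℝ) + 1)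
  have hεpos : ∀ m i, 0 < ε m i := fun m i => Nat.one_div_pos_of_nat
  have hεanti : Antitone ε := fun m m' h i => Nat.one_div_le_one_div h
  have hεlim : Tendsto ε atTop (𝓝 0) :=
    tendsto_pi_nhds.mpr fun i => tendsto_one_div_add_atTop_nhds_zero_nat
  choose h hfix hgr using fun m => hpert (ε m) fun i => (hεpos m i).le
  have hanti : Antitone h := fun m m' hm => hgr m _
    ((hfix m').symm.le.trans (add_le_add_right (hεanti hm) _))
  have hge : ∀ m, g ≤ h m := fun m => hgr m g
    (hg.symm.le.trans (le_add_of_nonneg_right fun i => (hεpos m i).le))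
  obtain ⟨l, hl⟩ : ∃ l, Tendsto h atTop (𝓝 l) :=
    ⟨fun i => ⨅ m, h m i, tendsto_pi_nhds.mpr fun i => tendsto_atTop_ciInf
      (fun m m' hm => hanti hm i) ⟨g i, by rintro _ ⟨m, rfl⟩; exact hge m i⟩⟩
  have hlfix : linEval false S y l = l := by
    have h₁ := ((continuous_linEval (S := S) (y := y)).tendsto l).comp hl |>.add hεlim
    rw [add_zero] at h₁
    exact tendsto_nhds_unique (h₁.congr hfix) hl
  have hlg : l = g := le_antisymm (hmax l hlfix.symm.le) (ge_of_tendsto' hl hge)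
  rw [hlg] at hl
  have hev : ∀ᶠ m in atTop, ∀ σ : Fin n → Bool,
      policyLin S σ y (h m) + ε m = h m → policyLin S σ y g = g := by
    rw [Filter.eventually_all]
    intro σ
    by_cases hσ : policyLin S σ y g = g
    · exact Eventually.of_forall fun _ _ => hσ
    · have h₁ := ((continuous_policyLin (S := S) (y := y) σ).tendsto g).comp hl |>.add hεlim
      rw [add_zero] at h₁
      filter_upwards [(h₁.sub hl).eventually_ne (sub_ne_zero.mpr hσ)] with m hm heq
      exact absurd (sub_eq_zero.mpr heq) hm
  obtain ⟨m, hm⟩ := hev.exists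
  have hσ : policyLin S (greedy S (h m)) y (h m) + ε m = h m := by
    rw [policyLin_greedy, hfix]
  refine ⟨greedy S (h m), ?_, hm _ hσ⟩
  have hA := jac_applyPolicy_nonneg hval hy0 (greedy S (h m))
  have hd : ∀ i, (jac (applyPolicy S (greedy S (h m))) y *ᵥ (h m - g)) i < (h m - g) i := by
    intro i
    rw [← policyLin_sub, hm _ hσ]
    have := congrFun hσ i
    simp only [Pi.add_apply, Pi.sub_apply] at *
    linarith [hεpos m i]
  refine isUnit_one_sub_of_subinvariant fun x hx => nonpos_of_le_mulVec hA
    (fun i => lt_of_le_of_lt ?_ (hd i)) hd hx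
  simp only [Matrix.mulVec, dotProduct]
  exact Finset.sum_nonneg fun j _ => mul_nonneg (hA i j) (sub_nonneg.mpr (hge m j))

open PPS in
/-- Let `x = P(x)` be a minPPS in SNF with LFP `0 < q* < 1`, and `0 ≤ y ≤ q*`.  Then
among all `a ∈ ℝ^n` with `P^y(a) ≥ a` there is a unique one, `I(y)`, maximizing
`∑ᵢ aᵢ`; moreover `I(y) = N_σ(y)` for some policy `σ`, and `P^y(I(y)) = I(y)`. -/
theorem stmt10 {n : ℕ} (S : Sys n) (hval : SysValid S)
    (q : Fin n → ℝ) (hq : IsLFP false S q) (h0 : ∀ i, 0 < q i) (h1 : ∀ i, q i < 1)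
    (y : Fin n → ℝ) (hy0 : ∀ i, 0 ≤ y i) (hyq : ∀ i, y i ≤ q i) :
    ∃ Iy : Fin n → ℝ,
      (∀ i, Iy i ≤ linEval false S y Iy i) ∧
      (∀ a : Fin n → ℝ, (∀ i, a i ≤ linEval false S y a i) → ∑ i, a i ≤ ∑ i, Iy i) ∧
      (∀ a : Fin n → ℝ, (∀ i, a i ≤ linEval false S y a i) →
        ∑ i, a i = ∑ i, Iy i → a = Iy) ∧
      (∃ σ : Fin n → Bool, IsUnit (1 - jac (applyPolicy S σ) y) ∧
        Iy = newton false (applyPolicy S σ) y) ∧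
      linEval false S y Iy = Iy := by
  have hy0' : (0 : Fin n → ℝ) ≤ y := hy0
  have hpert := fun (ε : Fin n → ℝ) (hε : 0 ≤ ε) =>
    hq.exists_greatest_linEval_add hval h0 h1 hy0' hyq hε
  obtain ⟨g, hg, hmax⟩ := hpert 0 le_rfl
  simp only [add_zero] at hg hmax
  refine ⟨g, fun i => (congrFun hg i).ge,
    fun a ha => Finset.sum_le_sum fun i _ => hmax a ha i, fun a ha hsum => ?_, ?_, hg⟩
  · funext i
    exact (Finset.sum_eq_sum_iff_of_le fun i _ => hmax a ha i).mp hsum i (Finset.mem_univ i)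
  · obtain ⟨σ, hU, hσ⟩ := exists_policy_of_greatest hval hy0' hpert hg hmax
    exact ⟨σ, hU, eq_newton_of_policyLin_eq hU hσ⟩
end
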